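/- arXiv:1003.1649 — 2 statements merged into one kernel-verified Lean document; each statement's English description precedes it below -/
import Mathlib

section
/- Let n ≥ 1 be an integer, M > 0, and let f : ℝⁿ → ℝ be Lipschitz with constant M (i.e. |f(x) − f(y)| ≤ M‖x − y‖ for all x, y). Then f is μ-integrable and for every c ≥ 0 one has the Gaussian concentration estimate μ({x ∈ ℝⁿ : |f(x) − ∫ f dμ| ≥ c}) ≤ 2·exp(−c²/(2M²)). -/
open MeasureTheory

/-- The standard Gaussian measure on `ℝⁿ`. -/
noncomputable def stdGaussian (n : ℕ) : Measure (EuclideanSpace ℝ (Fin n)) :=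
  volume.withDensity fun x =>
    ENNReal.ofReal ((2 * Real.pi) ^ (-(n : ℝ) / 2) * Real.exp (-‖x‖ ^ 2 / 2))

open scoped NNReal

namespace ProbabilityTheory

variable {E : Type*} [NormedAddCommGroup E] [InnerProductSpace ℝ E] [FiniteDimensional ℝ E]
  [MeasurableSpace E] [BorelSpace E]

lemma integrable_exp_mul_norm_stdGaussian (a : ℝ) :
    Integrable (fun z : E ↦ Real.exp (a * ‖z‖)) (stdGaussian E) := by
  obtain ⟨C, hC, hint⟩ := IsGaussian.exists_integrable_exp_sq (stdGaussian E)
  refine (hint.const_mul (Real.exp (a ^ 2 / (4 * C)))).mono' (by fun_prop) (ae_of_all _ fun z ↦ ?_)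
  rw [Real.norm_eq_abs, Real.abs_exp, ← Real.exp_add, Real.exp_le_exp]
  have h : a ^ 2 / (4 * C) + C * ‖z‖ ^ 2 - a * ‖z‖ = C * (‖z‖ - a / (2 * C)) ^ 2 := by
    field_simp; ring
  nlinarith [mul_nonneg hC.le (sq_nonneg (‖z‖ - a / (2 * C)))]

lemma integrable_norm_stdGaussian : Integrable (fun z : E ↦ ‖z‖) (stdGaussian E) :=
  IsGaussian.integrable_id.norm

lemma map_smul_conv_map_smul_stdGaussian (a b : ℝ) :
    (stdGaussian E).map (a • ·) ∗ (stdGaussian E).map (b • ·) =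
      (stdGaussian E).map (√(a ^ 2 + b ^ 2) • ·) := by
  have := Measure.isProbabilityMeasure_map (μ := stdGaussian E) (f := (a • ·)) (by fun_prop)
  have := Measure.isProbabilityMeasure_map (μ := stdGaussian E) (f := (b • ·)) (by fun_prop)
  have := Measure.isProbabilityMeasure_map (μ := stdGaussian E)
    (f := (√(a ^ 2 + b ^ 2) • ·)) (by fun_prop)
  refine Measure.ext_of_charFun ?_
  ext t
  rw [charFun_conv, charFun_map_smul, charFun_map_smul, charFun_map_smul, charFun_stdGaussian,
    charFun_stdGaussian, charFun_stdGaussian, ← Complex.exp_add, norm_smul, norm_smul, norm_smul]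
  congr 1
  norm_cast
  simp only [mul_pow, Real.norm_eq_abs, sq_abs]
  rw [Real.sq_sqrt (by positivity)]
  ring

lemma integral_sqrt_smul_stdGaussian {F : E → ℝ} (hF : Continuous F) (a b : ℝ)
    (hint : Integrable (fun z ↦ F (√(a ^ 2 + b ^ 2) • z)) (stdGaussian E)) :
    ∫ z, F (√(a ^ 2 + b ^ 2) • z) ∂stdGaussian E =
      ∫ y, ∫ z, F (a • y + b • z) ∂stdGaussian E ∂stdGaussian E := by
  have hsm : AEStronglyMeasurable F ((stdGaussian E).map (√(a ^ 2 + b ^ 2) • ·)) :=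
    hF.aestronglyMeasurable
  have h : Integrable F ((stdGaussian E).map (√(a ^ 2 + b ^ 2) • ·)) :=
    (integrable_map_measure hsm (by fun_prop)).2 hint
  rw [← integral_map (φ := (√(a ^ 2 + b ^ 2) • ·)) (by fun_prop) hsm,
    ← map_smul_conv_map_smul_stdGaussian, integral_conv]
  · rw [integral_map (by fun_prop)]
    · congr with y
      rw [integral_map (by fun_prop)]
      exact (hF.comp (by fun_prop)).aestronglyMeasurable
    · refine StronglyMeasurable.aestronglyMeasurable ?_
      refine StronglyMeasurable.integral_prod_right (f := fun x y => F (x + y)) ?_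
      exact (hF.comp (by fun_prop)).stronglyMeasurable
  · rwa [map_smul_conv_map_smul_stdGaussian]

lemma integrable_comp_add_smul_stdGaussian {K : ℝ≥0} {g : E → ℝ} (hg : LipschitzWith K g)
    (x : E) (r : ℝ) : Integrable (fun z ↦ g (x + r • z)) (stdGaussian E) := by
  refine ((integrable_const |g x|).add
    ((integrable_norm_stdGaussian (E := E)).const_mul (K * |r|))).mono'
    (hg.continuous.comp (by fun_prop)).aestronglyMeasurable (ae_of_all _ fun z ↦ ?_)
  have h := hg.dist_le_mul (x + r • z) x
  simp only [dist_eq_norm, add_sub_cancel_left, norm_smul, Real.norm_eq_abs] at h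
  have := abs_sub_abs_le_abs_sub (g (x + r • z)) (g x)
  simp only [Pi.add_apply, Real.norm_eq_abs]
  linarith

lemma integrable_exp_comp_add_smul_stdGaussian {K : ℝ≥0} {g : E → ℝ} (hg : LipschitzWith K g)
    (x : E) (r : ℝ) : Integrable (fun z ↦ Real.exp (g (x + r • z))) (stdGaussian E) := by
  refine ((integrable_exp_mul_norm_stdGaussian (E := E) (K * |r|)).const_mul
    (Real.exp (g x))).mono'
    (Real.continuous_exp.comp (hg.continuous.comp (by fun_prop))).aestronglyMeasurable
    (ae_of_all _ fun z ↦ ?_)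
  have h := hg.dist_le_mul (x + r • z) x
  simp only [dist_eq_norm, add_sub_cancel_left, norm_smul, Real.norm_eq_abs] at h
  rw [Real.norm_eq_abs, Real.abs_exp, ← Real.exp_add, Real.exp_le_exp]
  linarith [le_abs_self (g (x + r • z) - g x)]

lemma lipschitzWith_integral_add_smul_stdGaussian {F : Type*} [NormedAddCommGroup F]
    [NormedSpace ℝ F] {K : ℝ≥0} {g : E → F}
    (hg : LipschitzWith K g) (r : ℝ)
    (hint : ∀ x, Integrable (fun z ↦ g (x + r • z)) (stdGaussian E)) :
    LipschitzWith K fun x ↦ ∫ z, g (x + r • z) ∂stdGaussian E := by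
  refine LipschitzWith.of_dist_le_mul fun x y ↦ ?_
  rw [dist_eq_norm, ← integral_sub (hint x) (hint y)]
  refine (norm_integral_le_of_norm_le_const (C := K * dist x y) (ae_of_all _ fun z ↦ ?_)).trans
    (by simp)
  rw [← dist_eq_norm]
  simpa using hg.dist_le_mul (x + r • z) (y + r • z)

lemma hasFDerivAt_integral_add_smul_stdGaussian {K C : ℝ≥0} {g : E → ℝ} (hg : LipschitzWith K g)
    (hd : Differentiable ℝ g) (hg' : LipschitzWith C (fderiv ℝ g)) (r : ℝ) (x : E) :
    HasFDerivAt (fun x ↦ ∫ z, g (x + r • z) ∂stdGaussian E)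
      (∫ z, fderiv ℝ g (x + r • z) ∂stdGaussian E) x := by
  refine hasFDerivAt_integral_of_dominated_of_fderiv_le (s := Set.univ) (bound := fun _ ↦ (K : ℝ))
    (F' := fun x z ↦ fderiv ℝ g (x + r • z))
    Filter.univ_mem (Filter.Eventually.of_forall fun x ↦
      (integrable_comp_add_smul_stdGaussian hg x r).aestronglyMeasurable)
    (integrable_comp_add_smul_stdGaussian hg x r)
    (hg'.continuous.comp (by fun_prop)).aestronglyMeasurable
    (ae_of_all _ fun z x _ ↦ norm_fderiv_le_of_lipschitz ℝ hg)
    (integrable_const _) (ae_of_all _ fun z x _ ↦ ?_)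
  exact (hasFDerivAt_comp_add_right (r • z)).2 (hd (x + r • z)).hasFDerivAt

lemma lipschitzWith_fderiv_integral_add_smul_stdGaussian {K C : ℝ≥0} {g : E → ℝ}
    (hg : LipschitzWith K g) (hd : Differentiable ℝ g) (hg' : LipschitzWith C (fderiv ℝ g))
    (r : ℝ) :
    LipschitzWith C (fderiv ℝ fun x ↦ ∫ z, g (x + r • z) ∂stdGaussian E) := by
  have h : (fderiv ℝ fun x ↦ ∫ z, g (x + r • z) ∂stdGaussian E) =
      fun x ↦ ∫ z, fderiv ℝ g (x + r • z) ∂stdGaussian E :=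
    funext fun x ↦ (hasFDerivAt_integral_add_smul_stdGaussian hg hd hg' r x).fderiv
  rw [h]
  refine lipschitzWith_integral_add_smul_stdGaussian hg' r fun x ↦ ?_
  exact (integrable_const (K : ℝ)).mono' (hg'.continuous.comp (by fun_prop)).aestronglyMeasurable
    (ae_of_all _ fun z ↦ norm_fderiv_le_of_lipschitz ℝ hg)


lemma exp_le_quadratic_add (y : ℝ) :
    Real.exp y ≤ 1 + y + y ^ 2 / 2 + |y| ^ 3 * Real.exp |y| := by
  have h := Complex.norm_exp_sub_sum_le_norm_mul_exp y 3
  simp only [Finset.sum_range_succ, Finset.sum_range_zero, Nat.factorial] at h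
  norm_num at h
  have h2 : ‖Complex.exp y - (1 + y + y ^ 2 / 2)‖ = |Real.exp y - (1 + y + y ^ 2 / 2)| := by
    rw [← Real.norm_eq_abs, ← Complex.norm_real]
    push_cast
    rfl
  rw [h2] at h
  linarith [le_abs_self (Real.exp y - (1 + y + y ^ 2 / 2))]

lemma pow_three_le_six_mul_exp {t : ℝ} (ht : 0 ≤ t) : t ^ 3 ≤ 6 * Real.exp t := by
  have := Real.pow_div_factorial_le_exp t ht 3
  norm_num [Nat.factorial] at this
  linarith

lemma integral_sq_strongDual_stdGaussian (L : StrongDual ℝ E) :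
    ∫ z, L z ^ 2 ∂stdGaussian E = ‖L‖ ^ 2 := by
  rw [← variance_dual_stdGaussian, variance_of_integral_eq_zero (by fun_prop) (by simp)]

/-- The second moment of the increment of a `C^{1,1}` Lipschitz function under a small Gaussian
displacement. -/
lemma integral_sq_increment_le {K C : ℝ≥0} {g : E → ℝ} (hg : LipschitzWith K g)
    (hd : Differentiable ℝ g) (hg' : LipschitzWith C (fderiv ℝ g)) (x : E) {r : ℝ} (hr : 0 ≤ r) :
    Integrable (fun z ↦ (g (x + r • z) - g x) ^ 2) (stdGaussian E) ∧
    ∫ z, (g (x + r • z) - g x) ^ 2 ∂stdGaussian E ≤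
      r ^ 2 * K ^ 2 + r ^ 3 * (12 * C * K * ∫ z : E, Real.exp ‖z‖ ∂stdGaussian E) := by
  set L := fderiv ℝ g x
  have hL : ‖L‖ ≤ K := norm_fderiv_le_of_lipschitz ℝ hg
  have hexp : Integrable (fun z : E ↦ Real.exp ‖z‖) (stdGaussian E) := by
    simpa using integrable_exp_mul_norm_stdGaussian (E := E) 1
  have hLint : Integrable (fun z ↦ L z ^ 2) (stdGaussian E) :=
    (IsGaussian.memLp_dual (stdGaussian E) L 2 (by simp)).integrable_sq
  have hbound : Integrable (fun z ↦ r ^ 2 * L z ^ 2 + r ^ 3 * (12 * C * K) * Real.exp ‖z‖)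
      (stdGaussian E) := (hLint.const_mul _).add (hexp.const_mul _)
  have hle : ∀ z, (g (x + r • z) - g x) ^ 2 ≤
      r ^ 2 * L z ^ 2 + r ^ 3 * (12 * C * K) * Real.exp ‖z‖ := by
    intro z
    have h1 : |g (x + r • z) - g x - r * L z| ≤ C * (r * ‖z‖) ^ 2 := by
      have hnorm : ‖x + r • z - x‖ = r * ‖z‖ := by
        simp [norm_smul, abs_of_nonneg hr]
      have := (convex_closedBall x (r * ‖z‖)).norm_image_sub_le_of_norm_fderiv_le' (𝕜 := ℝ)
        (f := g) (φ := L) (C := C * (r * ‖z‖)) (x := x) (y := x + r • z) (fun y _ ↦ hd y)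
        (fun y hy ↦ by
          rw [← dist_eq_norm]
          exact (hg'.dist_le_mul y x).trans (by gcongr; exact hy))
        (by simp; positivity) (by rw [Metric.mem_closedBall, dist_eq_norm, hnorm])
      rw [hnorm] at this
      simp only [add_sub_cancel_left, map_smul, smul_eq_mul, Real.norm_eq_abs] at this
      linarith
    have h2 : |g (x + r • z) - g x| ≤ K * (r * ‖z‖) := by
      have := hg.dist_le_mul (x + r • z) x
      simpa [dist_eq_norm, norm_smul, abs_of_nonneg hr] using this
    have h3 : |r * L z| ≤ K * (r * ‖z‖) := by
      rw [abs_mul, abs_of_nonneg hr]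
      have := L.le_of_opNorm_le hL z
      rw [Real.norm_eq_abs] at this
      nlinarith
    have h4 := abs_add_le (g (x + r • z) - g x) (r * L z)
    have h5 : (g (x + r • z) - g x) ^ 2 - (r * L z) ^ 2 ≤
        (C * (r * ‖z‖) ^ 2) * (2 * (K * (r * ‖z‖))) := by
      calc _ ≤ |(g (x + r • z) - g x) ^ 2 - (r * L z) ^ 2| := le_abs_self _
        _ = |g (x + r • z) - g x - r * L z| * |g (x + r • z) - g x + r * L z| := by
          rw [← abs_mul]; ring_nf
        _ ≤ _ := by gcongr; linarith
    have h6 := mul_le_mul_of_nonneg_left (pow_three_le_six_mul_exp (norm_nonneg z))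
      (by positivity : 0 ≤ 2 * C * K * r ^ 3)
    nlinarith
  have hint : Integrable (fun z ↦ (g (x + r • z) - g x) ^ 2) (stdGaussian E) :=
    hbound.mono'
      (((hg.continuous.comp (by fun_prop)).sub continuous_const).pow 2).aestronglyMeasurable
      (ae_of_all _ fun z ↦ by rw [Real.norm_eq_abs, abs_of_nonneg (sq_nonneg _)]; exact hle z)
  refine ⟨hint, (integral_mono hint hbound hle).trans ?_⟩
  rw [integral_add (hLint.const_mul _) (hexp.const_mul _), integral_const_mul, integral_const_mul,
    integral_sq_strongDual_stdGaussian]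
  have : ‖L‖ ^ 2 ≤ (K : ℝ) ^ 2 := by gcongr
  nlinarith [mul_le_mul_of_nonneg_left this (sq_nonneg r)]

/-- Exponential moment of a `C^{1,1}` Lipschitz function under a small Gaussian displacement. -/
lemma exists_integral_exp_add_smul_le (K C : ℝ≥0) :
    ∃ B : ℝ, 0 ≤ B ∧ ∀ g : E → ℝ, LipschitzWith K g → Differentiable ℝ g →
      LipschitzWith C (fderiv ℝ g) → ∀ (x : E) (r : ℝ), 0 ≤ r → r ≤ 1 →
      ∫ z, Real.exp (g (x + r • z)) ∂stdGaussian E ≤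
        Real.exp (∫ z, g (x + r • z) ∂stdGaussian E) * (1 + r ^ 2 * K ^ 2 / 2 + B * r ^ 3) := by
  set m : ℝ := ∫ z : E, ‖z‖ ∂stdGaussian E
  have hm : 0 ≤ m := integral_nonneg fun z ↦ norm_nonneg z
  set B₁ : ℝ := 12 * C * K * ∫ z : E, Real.exp ‖z‖ ∂stdGaussian E
  have hB₁ : 0 ≤ B₁ := mul_nonneg (by positivity) (integral_nonneg fun z ↦ (Real.exp_pos _).le)
  set B₂ : ℝ := ∫ z : E, 6 * Real.exp (2 * (K * (‖z‖ + m))) ∂stdGaussian E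
  have hB₂ : 0 ≤ B₂ := integral_nonneg fun z ↦ by positivity
  have hB₂int : Integrable (fun z : E ↦ 6 * Real.exp (2 * (K * (‖z‖ + m)))) (stdGaussian E) := by
    have := (integrable_exp_mul_norm_stdGaussian (E := E) (2 * K)).const_mul
      (6 * Real.exp (2 * (K * m)))
    refine this.congr (ae_of_all _ fun z ↦ ?_)
    beta_reduce
    rw [mul_assoc, ← Real.exp_add]
    ring_nf
  refine ⟨B₁ / 2 + B₂, by positivity, fun g hg hd hg' x r hr hr1 ↦ ?_⟩
  obtain ⟨hsqint, hsq⟩ := integral_sq_increment_le hg hd hg' x hr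
  have hgint := integrable_comp_add_smul_stdGaussian hg x r
  set a := ∫ z, g (x + r • z) ∂stdGaussian E with ha
  have hDint : Integrable (fun z ↦ g (x + r • z) - g x) (stdGaussian E) :=
    hgint.sub (integrable_const _)
  have hDmean : ∫ z, (g (x + r • z) - g x) ∂stdGaussian E = a - g x := by
    rw [integral_sub hgint (integrable_const _)]; simp [ha]
  have hD : ∀ z, |g (x + r • z) - g x| ≤ r * (K * ‖z‖) := fun z ↦ by
    have := hg.dist_le_mul (x + r • z) x
    simp only [dist_eq_norm, norm_smul, Real.norm_eq_abs, abs_of_nonneg hr,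
      add_sub_cancel_left] at this
    linarith
  have hax : |a - g x| ≤ r * (K * m) := by
    rw [← hDmean]
    refine (abs_integral_le_integral_abs).trans ?_
    refine (integral_mono hDint.abs
      (((integrable_norm_stdGaussian (E := E)).const_mul _).const_mul _) hD).trans_eq ?_
    rw [integral_const_mul, integral_const_mul]
  have hY : ∀ z, |g (x + r • z) - a| ≤ r * (K * (‖z‖ + m)) := fun z ↦ by
    have := abs_sub (g (x + r • z) - g x) (a - g x)
    rw [sub_sub_sub_cancel_right] at this
    linarith [hD z]
  have hYmean : ∫ z, (g (x + r • z) - a) ∂stdGaussian E = 0 := by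
    rw [integral_sub hgint (integrable_const _)]; simp [ha]
  have hYint : Integrable (fun z ↦ g (x + r • z) - a) (stdGaussian E) :=
    hgint.sub (integrable_const _)
  have hDae : AEStronglyMeasurable (fun z ↦ g (x + r • z) - g x) (stdGaussian E) :=
    hDint.aestronglyMeasurable
  have hYsq : Integrable (fun z ↦ (g (x + r • z) - a) ^ 2) (stdGaussian E) := by
    have h1 : MemLp (fun z ↦ g (x + r • z) - g x) 2 (stdGaussian E) :=
      (memLp_two_iff_integrable_sq hDae).2 hsqint
    have h2 := (h1.sub (memLp_const (a - g x))).integrable_sq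
    simpa using h2
  have hvar : ∫ z, (g (x + r • z) - a) ^ 2 ∂stdGaussian E ≤ r ^ 2 * K ^ 2 + r ^ 3 * B₁ := by
    have := variance_le_expectation_sq hDae
    rw [variance_eq_integral hDae.aemeasurable, hDmean] at this
    simp only [sub_sub_sub_cancel_right, Pi.pow_apply] at this
    exact this.trans hsq
  have hpt : ∀ z, Real.exp (g (x + r • z) - a) ≤ 1 + (g (x + r • z) - a) +
      (g (x + r • z) - a) ^ 2 / 2 + r ^ 3 * (6 * Real.exp (2 * (K * (‖z‖ + m)))) := fun z ↦ by
    refine (exp_le_quadratic_add _).trans (add_le_add_right ?_ _)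
    have hw : 0 ≤ K * (‖z‖ + m) := by positivity
    calc _ ≤ (r * (K * (‖z‖ + m))) ^ 3 * Real.exp (K * (‖z‖ + m)) := by
            gcongr
            · exact hY z
            · exact (hY z).trans (mul_le_of_le_one_left hw hr1)
      _ ≤ r ^ 3 * (6 * Real.exp (K * (‖z‖ + m))) * Real.exp (K * (‖z‖ + m)) := by
            rw [mul_pow]
            gcongr
            exact pow_three_le_six_mul_exp hw
      _ = _ := by rw [two_mul, Real.exp_add]; ring
  have hmain : ∫ z, Real.exp (g (x + r • z) - a) ∂stdGaussian E ≤
      1 + r ^ 2 * K ^ 2 / 2 + (B₁ / 2 + B₂) * r ^ 3 := by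
    have hexpint : Integrable (fun z ↦ Real.exp (g (x + r • z) - a)) (stdGaussian E) := by
      simp_rw [Real.exp_sub]
      exact (integrable_exp_comp_add_smul_stdGaussian hg x r).div_const _
    have i1 := (integrable_const (μ := stdGaussian E) (1 : ℝ)).add hYint
    have i2 := i1.add (hYsq.div_const 2)
    have i3 := hB₂int.const_mul (r ^ 3)
    refine (integral_mono hexpint (i2.add i3) hpt).trans ?_
    rw [integral_add' i2 i3, integral_add' i1 (hYsq.div_const 2),
      integral_add' (integrable_const _) hYint, hYmean, integral_div, integral_const_mul]
    simp only [integral_const, probReal_univ, smul_eq_mul]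
    nlinarith
  calc _ = Real.exp a * ∫ z, Real.exp (g (x + r • z) - a) ∂stdGaussian E := by
        rw [← integral_const_mul]
        congr with z
        rw [← Real.exp_add, add_sub_cancel]
    _ ≤ _ := by gcongr

/-- Iterating the one-step bound along the Gaussian convolution semigroup. -/
lemma integral_exp_add_sqrt_smul_le {K C : ℝ≥0} {r δ : ℝ} (hr : 0 ≤ r) (hδ : 0 ≤ δ)
    (h : ∀ g : E → ℝ, LipschitzWith K g → Differentiable ℝ g → LipschitzWith C (fderiv ℝ g) →
      ∀ x : E, ∫ z, Real.exp (g (x + r • z)) ∂stdGaussian E ≤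
        Real.exp (∫ z, g (x + r • z) ∂stdGaussian E) * δ) (k : ℕ) :
    ∀ g : E → ℝ, LipschitzWith K g → Differentiable ℝ g → LipschitzWith C (fderiv ℝ g) →
      ∀ x : E, ∫ z, Real.exp (g (x + (√k * r) • z)) ∂stdGaussian E ≤
        Real.exp (∫ z, g (x + (√k * r) • z) ∂stdGaussian E) * δ ^ k := by
  induction k with
  | zero => intro g _ _ _ x; simp
  | succ k ih =>
    intro g hg hd hg' x
    have hc : √((k + 1 : ℕ) : ℝ) * r = √((√k * r) ^ 2 + r ^ 2) := by
      rw [mul_pow, Real.sq_sqrt (by positivity), ← add_one_mul, Real.sqrt_mul (by positivity),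
        Real.sqrt_sq hr]
      push_cast
      rfl
    set P : E → ℝ := fun y ↦ ∫ z, g (y + r • z) ∂stdGaussian E with hP
    have hPl : LipschitzWith K P := lipschitzWith_integral_add_smul_stdGaussian hg r
      fun y ↦ integrable_comp_add_smul_stdGaussian hg y r
    have hPd : Differentiable ℝ P := fun y ↦
      (hasFDerivAt_integral_add_smul_stdGaussian hg hd hg' r y).differentiableAt
    have hPl' := lipschitzWith_fderiv_integral_add_smul_stdGaussian hg hd hg' r
    have hgc := hg.continuous
    have e1 := integral_sqrt_smul_stdGaussian (F := fun y ↦ Real.exp (g (x + y))) (by fun_prop)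
      (√k * r) r (integrable_exp_comp_add_smul_stdGaussian hg x _)
    have e2 := integral_sqrt_smul_stdGaussian (F := fun y ↦ g (x + y)) (by fun_prop)
      (√k * r) r (integrable_comp_add_smul_stdGaussian hg x _)
    simp only [← add_assoc] at e1 e2
    rw [hc, e1, e2]
    have hPint := integrable_exp_comp_add_smul_stdGaussian hPl x (√k * r)
    calc _ ≤ ∫ y, Real.exp (P (x + (√k * r) • y)) * δ ∂stdGaussian E := by
          refine integral_mono_of_nonneg (ae_of_all _ fun y ↦ integral_nonneg fun z ↦
            (Real.exp_pos _).le) (hPint.mul_const δ) (ae_of_all _ fun y ↦ h g hg hd hg' _)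
      _ = (∫ y, Real.exp (P (x + (√k * r) • y)) ∂stdGaussian E) * δ := integral_mul_const _ _
      _ ≤ Real.exp (∫ y, P (x + (√k * r) • y) ∂stdGaussian E) * δ ^ k * δ := by
          gcongr
          exact ih P hPl hPd hPl' x
      _ = _ := by rw [pow_succ, mul_assoc]

open Filter Topology in
lemma integral_exp_le_of_lipschitzWith_fderiv {K C : ℝ≥0} {g : E → ℝ} (hg : LipschitzWith K g)
    (hd : Differentiable ℝ g) (hg' : LipschitzWith C (fderiv ℝ g)) :
    ∫ z, Real.exp (g z) ∂stdGaussian E ≤ Real.exp (∫ z, g z ∂stdGaussian E + K ^ 2 / 2) := by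
  obtain ⟨B, hB, hstep⟩ := exists_integral_exp_add_smul_le (E := E) K C
  have hlim : Tendsto (fun k : ℕ ↦ Real.exp (∫ z, g z ∂stdGaussian E + (K ^ 2 / 2 + B * (1 / √k))))
      atTop (𝓝 (Real.exp (∫ z, g z ∂stdGaussian E + (K ^ 2 / 2 + B * 0)))) := by
    have h0 : Tendsto (fun k : ℕ ↦ 1 / √(k : ℝ)) atTop (𝓝 0) := by
      simp_rw [one_div]
      exact tendsto_inv_atTop_zero.comp (Real.tendsto_sqrt_atTop.comp tendsto_natCast_atTop_atTop)
    exact (Real.continuous_exp.tendsto _).comp ((h0.const_mul B).const_add _ |>.const_add _)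
  rw [mul_zero, add_zero] at hlim
  refine ge_of_tendsto hlim ?_
  filter_upwards [eventually_ge_atTop 1] with k hk
  have hk1 : (1 : ℝ) ≤ √k := by
    rw [Real.one_le_sqrt]; exact_mod_cast hk
  have hk0 : (0 : ℝ) < √k := by linarith
  have hr1 : 1 / √(k : ℝ) ≤ 1 := by rw [div_le_one hk0]; exact hk1
  have h := integral_exp_add_sqrt_smul_le (E := E) (K := K) (C := C) (r := 1 / √k)
    (δ := 1 + (1 / √k) ^ 2 * K ^ 2 / 2 + B * (1 / √k) ^ 3) (by positivity) (by positivity)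
    (fun g hg hd hg' x ↦ hstep g hg hd hg' x _ (by positivity) hr1) k g hg hd hg' 0
  rw [mul_one_div_cancel hk0.ne'] at h
  simp only [zero_add, one_smul] at h
  refine h.trans ?_
  rw [Real.exp_add]
  gcongr
  have hkδ : (k : ℝ) * ((1 / √k) ^ 2 * K ^ 2 / 2 + B * (1 / √k) ^ 3) =
      K ^ 2 / 2 + B * (1 / √k) := by
    have : (k : ℝ) * (1 / √k) ^ 2 = 1 := by
      rw [div_pow, Real.sq_sqrt (by positivity)]
      have : (k : ℝ) ≠ 0 := by positivity
      field_simp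
    linear_combination (K ^ 2 / 2 + B * (1 / √k)) * this
  rw [← hkδ, Real.exp_nat_mul]
  gcongr
  rw [add_assoc, add_comm]
  exact Real.add_one_le_exp _

/-- A Lipschitz function is a uniform limit of functions with the same Lipschitz constant and
Lipschitz derivative. -/
lemma exists_lipschitzWith_fderiv_dist_le {K : ℝ≥0} {f : E → ℝ} (hf : LipschitzWith K f) {ε : ℝ}
    (hε : 0 < ε) :
    ∃ (C : ℝ≥0) (g : E → ℝ), LipschitzWith K g ∧ Differentiable ℝ g ∧
      LipschitzWith C (fderiv ℝ g) ∧ ∀ x, |g x - f x| ≤ ε := by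
  set δ : ℝ := ε / (K + 1)
  have hδ : 0 < δ := by positivity
  let φ : ContDiffBump (0 : E) := ⟨δ / 2, δ, by positivity, by linarith⟩
  set ψ : E → ℝ := φ.normed volume
  have hψ : ContDiff ℝ 1 ψ := φ.contDiff_normed
  have hψs : HasCompactSupport ψ := φ.hasCompactSupport_normed
  have hψc : Continuous ψ := hψ.continuous
  have hψ'c : Continuous (fderiv ℝ ψ) := hψ.continuous_fderiv one_ne_zero
  have hψ's : HasCompactSupport (fderiv ℝ ψ) := hψs.fderiv ℝ
  have hfc := hf.continuous
  have hint : ∀ x, Integrable (fun t ↦ ψ t * f (x - t)) := fun x ↦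
    (hψc.mul (by fun_prop)).integrable_of_hasCompactSupport hψs.mul_right
  have hint' : ∀ x, Integrable (fun t ↦ f (x - t) • fderiv ℝ ψ t) := fun x ↦
    (Continuous.smul (f := fun t ↦ f (x - t)) (by fun_prop) hψ'c).integrable_of_hasCompactSupport
      hψ's.smul_left
  have hD : ∀ x, HasFDerivAt (fun x ↦ ∫ t, ψ t * f (x - t))
      (∫ t, f (x - t) • fderiv ℝ ψ t) x := by
    intro x
    have h := hψs.hasFDerivAt_convolution_left (ContinuousLinearMap.lsmul ℝ ℝ) hψ
      (hfc.locallyIntegrable (μ := volume)) x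
    have h' : (convolution (fderiv ℝ ψ) f ((ContinuousLinearMap.lsmul ℝ ℝ).precompL E) volume) x =
        ∫ t, f (x - t) • fderiv ℝ ψ t := by
      unfold convolution
      congr with t v
      simp [ContinuousLinearMap.precompL_apply, mul_comm]
    rw [h'] at h
    exact h
  refine ⟨K * (∫ t, ‖fderiv ℝ ψ t‖).toNNReal,
    fun x ↦ ∫ t, ψ t * f (x - t), ?_, fun x ↦ (hD x).differentiableAt, ?_, fun x ↦ ?_⟩
  · refine LipschitzWith.of_dist_le_mul fun x y ↦ ?_
    rw [dist_eq_norm, ← integral_sub (hint x) (hint y)]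
    refine (norm_integral_le_of_norm_le (g := fun t ↦ ψ t * (K * dist x y))
      (φ.integrable_normed.mul_const _) (ae_of_all _ fun t ↦ ?_)).trans_eq ?_
    · rw [← mul_sub, norm_mul, Real.norm_of_nonneg (φ.nonneg_normed t), ← dist_eq_norm]
      gcongr
      · exact φ.nonneg_normed t
      · simpa using hf.dist_le_mul (x - t) (y - t)
    · rw [integral_mul_const, φ.integral_normed, one_mul]
  · rw [funext fun x ↦ (hD x).fderiv]
    refine LipschitzWith.of_dist_le_mul fun x y ↦ ?_
    rw [dist_eq_norm, ← integral_sub (hint' x) (hint' y)]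
    refine (norm_integral_le_of_norm_le (g := fun t ↦ K * dist x y * ‖fderiv ℝ ψ t‖)
      ((hψ'c.integrable_of_hasCompactSupport hψ's).norm.const_mul _)
      (ae_of_all _ fun t ↦ ?_)).trans_eq ?_
    · rw [← sub_smul, norm_smul, ← dist_eq_norm]
      gcongr
      simpa using hf.dist_le_mul (x - t) (y - t)
    · rw [integral_const_mul]
      rw [NNReal.coe_mul, Real.coe_toNNReal _ (integral_nonneg fun t ↦ norm_nonneg _)]
      ring
  · have := φ.dist_normed_convolution_le (μ := volume) (g := f) (x₀ := x) (ε := ε)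
      hfc.aestronglyMeasurable fun y hy ↦ by
        refine (hf.dist_le_mul y x).trans ?_
        have h1 : dist y x ≤ δ := (Metric.mem_ball.1 hy).le
        calc (K : ℝ) * dist y x ≤ (K + 1) * δ := by gcongr; linarith
          _ = ε := by simp only [δ]; field_simp
    simpa [convolution, Real.dist_eq] using this

open Filter Topology in
/-- **Exponential moments of Lipschitz functions of a Gaussian vector.** -/
theorem integral_exp_le_of_lipschitzWith {K : ℝ≥0} {f : E → ℝ} (hf : LipschitzWith K f) :
    ∫ z, Real.exp (f z) ∂stdGaussian E ≤ Real.exp (∫ z, f z ∂stdGaussian E + K ^ 2 / 2) := by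
  have hint : ∀ {g : E → ℝ}, LipschitzWith K g → Integrable g (stdGaussian E) := fun hg ↦ by
    simpa using integrable_comp_add_smul_stdGaussian hg 0 1
  have hexp : ∀ {g : E → ℝ}, LipschitzWith K g →
      Integrable (fun z ↦ Real.exp (g z)) (stdGaussian E) := fun hg ↦ by
    simpa using integrable_exp_comp_add_smul_stdGaussian hg 0 1
  have hlim : Tendsto (fun ε : ℝ ↦
      Real.exp ε * Real.exp (∫ z, f z ∂stdGaussian E + ε + K ^ 2 / 2)) (𝓝[>] 0)
      (𝓝 (Real.exp 0 * Real.exp (∫ z, f z ∂stdGaussian E + 0 + K ^ 2 / 2))) :=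
    (Continuous.tendsto (by fun_prop) 0).mono_left nhdsWithin_le_nhds
  rw [Real.exp_zero, one_mul, add_zero] at hlim
  refine ge_of_tendsto hlim ?_
  filter_upwards [self_mem_nhdsWithin] with ε hε
  obtain ⟨C, g, hg, hd, hg', hgf⟩ := exists_lipschitzWith_fderiv_dist_le hf hε
  calc _ ≤ ∫ z, Real.exp ε * Real.exp (g z) ∂stdGaussian E := by
        refine integral_mono (hexp hf) ((hexp hg).const_mul _) fun z ↦ ?_
        simp only [← Real.exp_add]
        gcongr
        linarith [(abs_le.1 (hgf z)).1]
    _ = Real.exp ε * ∫ z, Real.exp (g z) ∂stdGaussian E := integral_const_mul _ _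
    _ ≤ Real.exp ε * Real.exp (∫ z, g z ∂stdGaussian E + K ^ 2 / 2) := by
        gcongr
        exact integral_exp_le_of_lipschitzWith_fderiv hg hd hg'
    _ ≤ _ := by
        gcongr
        have h := integral_mono (hint hg) ((hint hf).add (integrable_const ε)) fun z ↦ by
          simp only [Pi.add_apply]; linarith [(abs_le.1 (hgf z)).2]
        rw [integral_add' (hint hf) (integrable_const ε)] at h
        simpa using h

lemma hasSubgaussianMGF_sub_integral_stdGaussian {K : ℝ≥0} {f : E → ℝ} (hf : LipschitzWith K f) :
    HasSubgaussianMGF (fun z ↦ f z - ∫ y, f y ∂stdGaussian E) (K ^ 2) (stdGaussian E) := by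
  have hlip : ∀ t : ℝ, LipschitzWith (‖t‖₊ * K) fun z ↦ t * f z := fun t ↦
    (lipschitzWith_smul t).comp hf
  refine ⟨fun t ↦ ?_, fun t ↦ ?_⟩
  · have h : Integrable (fun z ↦ Real.exp (t * f z)) (stdGaussian E) := by
      simpa using integrable_exp_comp_add_smul_stdGaussian (hlip t) 0 1
    simp_rw [mul_sub, Real.exp_sub]
    exact h.div_const _
  · have h := integral_exp_le_of_lipschitzWith (hlip t)
    simp_rw [mgf, mul_sub, Real.exp_sub]
    rw [integral_div, div_le_iff₀ (Real.exp_pos _), ← Real.exp_add]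
    refine h.trans_eq ?_
    rw [integral_const_mul]
    push_cast
    rw [mul_pow, Real.norm_eq_abs, sq_abs]
    ring_nf

end ProbabilityTheory

lemma stdGaussian_eq_probabilityTheory_stdGaussian (n : ℕ) :
    stdGaussian n = ProbabilityTheory.stdGaussian (EuclideanSpace ℝ (Fin n)) := by
  have hint : Integrable (fun x : EuclideanSpace ℝ (Fin n) ↦
      (2 * Real.pi) ^ (-(n : ℝ) / 2) * Real.exp (-‖x‖ ^ 2 / 2)) := by
    refine Integrable.const_mul ?_ _
    refine Integrable.of_integral_ne_zero ?_
    have h := GaussianFourier.integral_rexp_neg_mul_sq_norm (V := EuclideanSpace ℝ (Fin n))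
      (b := 1 / 2) (by norm_num)
    have h2 : ∀ x : EuclideanSpace ℝ (Fin n), -‖x‖ ^ 2 / 2 = -(1 / 2) * ‖x‖ ^ 2 :=
      fun x ↦ by ring
    simp_rw [h2, h]
    positivity
  have : IsFiniteMeasure (stdGaussian n) := isFiniteMeasure_withDensity_ofReal hint.2
  refine Measure.ext_of_charFun ?_
  ext t
  have h := GaussianFourier.integral_cexp_neg_mul_sq_norm_add (b := 1 / 2) (by norm_num)
    Complex.I t
  have hpi : (2 * Real.pi : ℝ) ^ (-(n : ℝ) / 2) * (2 * Real.pi) ^ ((n : ℝ) / 2) = 1 := by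
    rw [← Real.rpow_add (by positivity)]
    ring_nf
    simp
  rw [ProbabilityTheory.charFun_stdGaussian, charFun_apply, stdGaussian,
    integral_withDensity_eq_integral_toReal_smul (by fun_prop) (by simp)]
  calc _ = ∫ v : EuclideanSpace ℝ (Fin n), (((2 * Real.pi) ^ (-(n : ℝ) / 2) : ℝ) : ℂ) *
        Complex.exp (-(1 / 2) * ‖v‖ ^ 2 + Complex.I * inner ℝ t v) := by
        congr with v
        rw [ENNReal.toReal_ofReal (by positivity), Complex.real_smul, Complex.ofReal_mul,
          Complex.ofReal_exp, mul_assoc, ← Complex.exp_add, real_inner_comm]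
        push_cast
        ring_nf
    _ = Complex.exp (-‖t‖ ^ 2 / 2) := by
        have h2 : ((Real.pi : ℂ) / (1 / 2)) ^ ((n : ℂ) / 2) =
            (((2 * Real.pi) ^ ((n : ℝ) / 2) : ℝ) : ℂ) := by
          rw [Complex.ofReal_cpow (by positivity)]
          push_cast
          ring_nf
        rw [integral_const_mul, h, finrank_euclideanSpace, Fintype.card_fin, h2, ← mul_assoc,
          ← Complex.ofReal_mul, hpi, Complex.I_sq]
        norm_num

/-- Gaussian concentration of Lipschitz functions (exponential tightness). -/
theorem gaussian_concentration (n : ℕ) (hn : 1 ≤ n) (M : ℝ) (hM : 0 < M)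
    (f : EuclideanSpace ℝ (Fin n) → ℝ)
    (hf : ∀ x y, |f x - f y| ≤ M * ‖x - y‖) :
    Integrable f (stdGaussian n) ∧
      ∀ c : ℝ, 0 ≤ c →
        stdGaussian n {x | c ≤ |f x - ∫ y, f y ∂stdGaussian n|}
          ≤ ENNReal.ofReal (2 * Real.exp (-c ^ 2 / (2 * M ^ 2))) := by
  lift M to ℝ≥0 using hM.le
  have hlip : LipschitzWith M f := LipschitzWith.of_dist_le_mul fun x y ↦ by
    simpa [dist_eq_norm] using hf x y
  rw [stdGaussian_eq_probabilityTheory_stdGaussian]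
  refine ⟨by simpa using ProbabilityTheory.integrable_comp_add_smul_stdGaussian hlip 0 1,
    fun c hc ↦ ?_⟩
  have hsub := ProbabilityTheory.hasSubgaussianMGF_sub_integral_stdGaussian hlip
  have h1 := hsub.measure_ge_le hc
  have h2 := hsub.neg.measure_ge_le hc
  push_cast at h1 h2
  simp_rw [le_abs]
  rw [Set.ofPred_or, two_mul, ENNReal.ofReal_add (Real.exp_pos _).le (Real.exp_pos _).le]
  refine (measure_union_le _ _).trans (add_le_add ?_ ?_)
  · exact (ENNReal.le_ofReal_iff_toReal_le (measure_ne_top _ _) (Real.exp_pos _).le).2 h1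
  · exact (ENNReal.le_ofReal_iff_toReal_le (measure_ne_top _ _) (Real.exp_pos _).le).2 h2
end

section
/- Let n ≥ 1 be an integer and suppose that ν satisfies the logarithmic Sobolev inequality with constant K > 0. Let f : ℝⁿ → ℝ be Lipschitz with constant 1. Then for every ε > 0 with εK < 1 one has ∫_{ℝⁿ} exp(ε f(x)²) dν(x) ≤ (1 − εK)^{−1/2} · exp( 2ε (∫ f dν)² / (1 − εK) ). -/
open MeasureTheory

/-- A Borel probability measure `ν` on `ℝⁿ` satisfies the logarithmic Sobolev
inequality with constant `K` if for every Lipschitz `g` with `0 < ∫ g² dν < ∞`,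
`∫ g² log(g²/∫g² dν) dν ≤ K ∫ ‖∇g‖² dν`, where the gradient is taken to be `0`
at points of non-differentiability. -/
def SatisfiesLogSobolev (n : ℕ) (ν : Measure (EuclideanSpace ℝ (Fin n)))
    (K : ℝ) : Prop :=
  ∀ g : EuclideanSpace ℝ (Fin n) → ℝ, (∃ L : NNReal, LipschitzWith L g) →
    Integrable (fun x => (g x) ^ 2) ν → 0 < ∫ x, (g x) ^ 2 ∂ν →
    ∫ x, (g x) ^ 2 * Real.log ((g x) ^ 2 / ∫ y, (g y) ^ 2 ∂ν) ∂ν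
      ≤ K * ∫ x, ‖gradient g x‖ ^ 2 ∂ν

open Filter Topology ProbabilityTheory

theorem LipschitzWith.exists_lipschitzWith_exp {α : Type*} [PseudoMetricSpace α] {L : NNReal}
    {u : α → ℝ} (hu : LipschitzWith L u) {M : ℝ} (hM : ∀ x, u x ≤ M) :
    ∃ C : NNReal, LipschitzWith C fun x => Real.exp (u x) := by
  have h : LipschitzOnWith (Real.exp M).toNNReal Real.exp (Set.Iic M) := by
    refine (convex_Iic M).lipschitzOnWith_of_nnnorm_deriv_le (𝕜 := ℝ)
      (fun x _ => Real.differentiableAt_exp) fun x hx => ?_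
    rw [← NNReal.coe_le_coe, coe_nnnorm, Real.coe_toNNReal _ (Real.exp_pos M).le, Real.deriv_exp,
      Real.norm_of_nonneg (Real.exp_pos x).le]
    exact Real.exp_le_exp.2 hx
  refine ⟨(Real.exp M).toNNReal * L, ?_⟩
  rw [← lipschitzOnWith_univ]
  exact h.comp (lipschitzOnWith_univ.2 hu) fun x _ => hM x

theorem norm_gradient_exp_mul_le {E : Type*} [NormedAddCommGroup E] [InnerProductSpace ℝ E]
    [CompleteSpace E] {f : E → ℝ} (hf : LipschitzWith 1 f) {c : ℝ} (hc : 0 < c) (x : E) :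
    ‖gradient (fun y => Real.exp (c * f y)) x‖ ≤ c * Real.exp (c * f x) := by
  rw [gradient, LinearIsometryEquiv.norm_map]
  by_cases hd : DifferentiableAt ℝ (fun y => Real.exp (c * f y)) x
  · have hfd : DifferentiableAt ℝ f x := by
      have h := (hd.log (Real.exp_pos _).ne').const_mul c⁻¹
      simpa [hc.ne'] using h
    have h := ((hfd.hasFDerivAt.const_mul c).exp).fderiv
    rw [h, norm_smul, norm_smul, Real.norm_of_nonneg (Real.exp_pos _).le,
      Real.norm_of_nonneg hc.le, mul_comm]
    have h1 : ‖fderiv ℝ f x‖ ≤ 1 := by simpa using norm_fderiv_le_of_lipschitz ℝ hf (x₀ := x)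
    gcongr
    exact mul_le_of_le_one_right hc.le h1
  · rw [fderiv_zero_of_not_differentiableAt hd, norm_zero]
    positivity

theorem integrableExpSet_eq_univ_of_abs_le {Ω : Type*} [MeasurableSpace Ω] {μ : Measure Ω}
    [IsFiniteMeasure μ] {X : Ω → ℝ} (hX : AEMeasurable X μ) {M : ℝ} (hM : ∀ ω, |X ω| ≤ M) :
    integrableExpSet X μ = Set.univ := by
  refine Set.eq_univ_of_forall fun t => ?_
  refine Integrable.of_bound (by fun_prop) (Real.exp (|t| * M)) (ae_of_all _ fun ω => ?_)
  rw [Real.norm_of_nonneg (Real.exp_pos _).le, Real.exp_le_exp]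
  calc t * X ω ≤ |t * X ω| := le_abs_self _
    _ = |t| * |X ω| := abs_mul _ _
    _ ≤ |t| * M := by gcongr; exact hM ω

/-- Applying the log-Sobolev inequality to `exp (t f / 2)` gives a differential inequality for the
moment generating function of `f`. -/
theorem SatisfiesLogSobolev.mul_deriv_mgf_le {n : ℕ} {ν : Measure (EuclideanSpace ℝ (Fin n))}
    [IsProbabilityMeasure ν] {K : ℝ} (hK : 0 < K) (hLSI : SatisfiesLogSobolev n ν K)
    {f : EuclideanSpace ℝ (Fin n) → ℝ} (hf : LipschitzWith 1 f) {M : ℝ} (hM : ∀ x, |f x| ≤ M)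
    {t : ℝ} (ht : 0 < t) :
    t * (∫ x, f x * Real.exp (t * f x) ∂ν) - mgf f ν t * Real.log (mgf f ν t)
      ≤ K * t ^ 2 / 4 * mgf f ν t := by
  have huniv := integrableExpSet_eq_univ_of_abs_le (μ := ν) hf.continuous.aemeasurable hM
  have hexp : Integrable (fun x => Real.exp (t * f x)) ν :=
    (huniv ▸ Set.mem_univ t : t ∈ integrableExpSet f ν)
  have hmul : Integrable (fun x => f x * Real.exp (t * f x)) ν :=
    hexp.bdd_mul hf.continuous.aestronglyMeasurable (ae_of_all _ hM)
  have hpos : 0 < mgf f ν t := mgf_pos hexp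
  have hsq : ∀ x, Real.exp (t / 2 * f x) ^ 2 = Real.exp (t * f x) := fun x => by
    rw [← Real.exp_nat_mul]; congr 1; push_cast; ring
  have hint : ∫ x, Real.exp (t / 2 * f x) ^ 2 ∂ν = mgf f ν t := by simp only [hsq, mgf]
  have hlip : ∃ L : NNReal, LipschitzWith L fun x => Real.exp (t / 2 * f x) := by
    have hL : LipschitzWith (‖t / 2‖₊ * 1) fun x => t / 2 * f x :=
      (lipschitzWith_smul (t / 2)).comp hf
    exact hL.exists_lipschitzWith_exp (M := t / 2 * M) fun x => by
      gcongr; exact (le_abs_self _).trans (hM x)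
  have key := hLSI _ hlip (by simpa only [hsq] using hexp) (hint ▸ hpos)
  rw [hint] at key
  have hlhs : ∫ x, Real.exp (t / 2 * f x) ^ 2 * Real.log (Real.exp (t / 2 * f x) ^ 2 / mgf f ν t) ∂ν
      = t * (∫ x, f x * Real.exp (t * f x) ∂ν) - mgf f ν t * Real.log (mgf f ν t) := by
    have : ∀ x, Real.exp (t / 2 * f x) ^ 2 * Real.log (Real.exp (t / 2 * f x) ^ 2 / mgf f ν t)
        = t * (f x * Real.exp (t * f x)) - Real.exp (t * f x) * Real.log (mgf f ν t) := fun x => by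
      rw [hsq, Real.log_div (Real.exp_pos _).ne' hpos.ne', Real.log_exp]; ring
    simp only [this]
    rw [integral_sub (hmul.const_mul t) (hexp.mul_const _), integral_const_mul, integral_mul_const]
    rfl
  have hrhs : ∫ x, ‖gradient (fun y => Real.exp (t / 2 * f y)) x‖ ^ 2 ∂ν
      ≤ t ^ 2 / 4 * mgf f ν t := by
    rw [mgf, ← integral_const_mul]
    refine integral_mono_of_nonneg (ae_of_all _ fun x => by positivity) (hexp.const_mul _)
      (ae_of_all _ fun x => ?_)
    calc ‖gradient (fun y => Real.exp (t / 2 * f y)) x‖ ^ 2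
        ≤ (t / 2 * Real.exp (t / 2 * f x)) ^ 2 := by
          gcongr; exact norm_gradient_exp_mul_le hf (half_pos ht) x
      _ = t ^ 2 / 4 * Real.exp (t * f x) := by rw [mul_pow, hsq]; ring
  rw [hlhs] at key
  calc _ ≤ _ := key
    _ ≤ K * (t ^ 2 / 4 * mgf f ν t) := by gcongr
    _ = _ := by ring

/-- Herbst's argument for bounded functions. -/
theorem SatisfiesLogSobolev.mgf_le_exp_of_pos {n : ℕ} {ν : Measure (EuclideanSpace ℝ (Fin n))}
    [IsProbabilityMeasure ν] {K : ℝ} (hK : 0 < K) (hLSI : SatisfiesLogSobolev n ν K)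
    {f : EuclideanSpace ℝ (Fin n) → ℝ} (hf : LipschitzWith 1 f) {M : ℝ} (hM : ∀ x, |f x| ≤ M)
    {t : ℝ} (ht : 0 < t) :
    mgf f ν t ≤ Real.exp (t * (∫ x, f x ∂ν) + K * t ^ 2 / 4) := by
  have huniv := integrableExpSet_eq_univ_of_abs_le (μ := ν) hf.continuous.aemeasurable hM
  have hpos : ∀ s, 0 < mgf f ν s := fun s =>
    mgf_pos (huniv ▸ Set.mem_univ s : s ∈ integrableExpSet f ν)
  have hderiv : ∀ s, HasDerivAt (fun s => Real.log (mgf f ν s))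
      ((∫ x, f x * Real.exp (s * f x) ∂ν) / mgf f ν s) s := fun s =>
    (hasDerivAt_mgf (by simp [huniv])).log (hpos s).ne'
  set φ : ℝ → ℝ := fun s => Real.log (mgf f ν s) / s - K * s / 4 with hφ
  have hφd : ∀ s, 0 < s → HasDerivAt φ
      (((∫ x, f x * Real.exp (s * f x) ∂ν) / mgf f ν s * s - Real.log (mgf f ν s) * 1) / s ^ 2
        - K * 1 / 4) s := fun s hs =>
    ((hderiv s).div (hasDerivAt_id s) hs.ne').sub (((hasDerivAt_id s).const_mul K).div_const 4)
  have hanti : AntitoneOn φ (Set.Ioi 0) := by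
    refine antitoneOn_of_deriv_nonpos (convex_Ioi 0)
      (fun s hs => (hφd s hs).continuousAt.continuousWithinAt)
      (fun s hs => (hφd s (interior_subset hs)).differentiableAt.differentiableWithinAt)
      fun s hs => ?_
    have hs : 0 < s := interior_subset hs
    rw [(hφd s hs).deriv, sub_nonpos, div_le_iff₀ (by positivity)]
    have h := hLSI.mul_deriv_mgf_le hK hf hM hs
    have hp := hpos s
    rw [mul_one, div_mul_eq_mul_div, sub_le_iff_le_add, div_le_iff₀ hp]
    linarith
  have hlim : Tendsto φ (𝓝[>] 0) (𝓝 (∫ x, f x ∂ν)) := by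
    have h0 := (hderiv 0).tendsto_slope_zero_right
    have h1 : Tendsto (fun s : ℝ => K * s / 4) (𝓝[>] 0) (𝓝 0) := by
      have : Tendsto (fun s : ℝ => K * s / 4) (𝓝 0) (𝓝 (K * 0 / 4)) :=
        Continuous.tendsto (by fun_prop) _
      simpa using this.mono_left nhdsWithin_le_nhds
    have h2 := h0.sub h1
    simpa [hφ, div_eq_inv_mul] using h2
  have hle : φ t ≤ ∫ x, f x ∂ν := by
    refine ge_of_tendsto hlim ?_
    filter_upwards [Ioo_mem_nhdsGT ht] with s hs
    exact hanti hs.1 ht hs.2.le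
  rw [← Real.log_le_iff_le_exp (hpos t)]
  have : Real.log (mgf f ν t) / t ≤ (∫ x, f x ∂ν) + K * t / 4 := by
    simp only [hφ] at hle; linarith
  rw [div_le_iff₀ ht] at this
  linarith

/-- A bounded `1`-Lipschitz function is sub-Gaussian under a log-Sobolev inequality. -/
theorem SatisfiesLogSobolev.mgf_le_exp {n : ℕ} {ν : Measure (EuclideanSpace ℝ (Fin n))}
    [IsProbabilityMeasure ν] {K : ℝ} (hK : 0 < K) (hLSI : SatisfiesLogSobolev n ν K)
    {f : EuclideanSpace ℝ (Fin n) → ℝ} (hf : LipschitzWith 1 f) {M : ℝ} (hM : ∀ x, |f x| ≤ M)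
    (t : ℝ) :
    mgf f ν t ≤ Real.exp (t * (∫ x, f x ∂ν) + K * t ^ 2 / 4) := by
  rcases lt_trichotomy t 0 with ht | rfl | ht
  · have h := hLSI.mgf_le_exp_of_pos hK hf.neg (f := -f) (M := M) (by simpa using hM) (neg_pos.2 ht)
    rw [mgf_neg, neg_neg] at h
    simpa [integral_neg] using h
  · simp
  · exact hLSI.mgf_le_exp_of_pos hK hf hM ht

theorem lintegral_exp_neg_mul_sq_add_mul {b : ℝ} (hb : 0 < b) (c : ℝ) :
    ∫⁻ z : ℝ, ENNReal.ofReal (Real.exp (-b * z ^ 2 + c * z))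
      = ENNReal.ofReal (√(Real.pi / b) * Real.exp (c ^ 2 / (4 * b))) := by
  have h : ∀ z : ℝ, ENNReal.ofReal (Real.exp (-b * z ^ 2 + c * z))
      = ENNReal.ofReal (Real.exp (-b * (z - c / (2 * b)) ^ 2))
        * ENNReal.ofReal (Real.exp (c ^ 2 / (4 * b))) := fun z => by
    rw [← ENNReal.ofReal_mul (Real.exp_pos _).le, ← Real.exp_add]
    congr 2
    field_simp
    ring
  simp only [h]
  rw [lintegral_mul_const _ (by fun_prop),
    lintegral_sub_right_eq_self (fun z : ℝ => ENNReal.ofReal (Real.exp (-b * z ^ 2))),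
    ← ofReal_integral_eq_lintegral_ofReal (integrable_exp_neg_mul_sq hb)
      (ae_of_all _ fun z => (Real.exp_pos _).le), integral_gaussian,
    ENNReal.ofReal_mul (Real.sqrt_nonneg _)]

/-- A sub-Gaussian bound on the moment generating function yields a bound on the exponential
moment of the square. -/
theorem lintegral_exp_mul_sq_le_of_mgf_le {Ω : Type*} [MeasurableSpace Ω] {μ : Measure Ω}
    [SFinite μ] {X : Ω → ℝ} (hX : Measurable X) (huniv : integrableExpSet X μ = Set.univ)
    {m K ε : ℝ} (hmgf : ∀ t, mgf X μ t ≤ Real.exp (t * m + K * t ^ 2 / 4))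
    (hε : 0 < ε) (hεK : ε * K < 1) :
    ∫⁻ ω, ENNReal.ofReal (Real.exp (ε * X ω ^ 2)) ∂μ
      ≤ ENNReal.ofReal ((1 - ε * K) ^ (-(1 : ℝ) / 2) * Real.exp (ε * m ^ 2 / (1 - ε * K))) := by
  have hs : √(2 * ε) ^ 2 = 2 * ε := Real.sq_sqrt (by positivity)
  have hd : 0 < 1 - ε * K := by linarith
  have hpi : 0 < √(2 * Real.pi) := Real.sqrt_pos.2 (by positivity)
  have hleft : ∫⁻ ω, (∫⁻ z : ℝ, ENNReal.ofReal
        (Real.exp (-(1 / 2) * z ^ 2 + (√(2 * ε) * X ω) * z))) ∂μ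
      = ENNReal.ofReal √(2 * Real.pi) * ∫⁻ ω, ENNReal.ofReal (Real.exp (ε * X ω ^ 2)) ∂μ := by
    rw [← lintegral_const_mul _ (by fun_prop)]
    refine lintegral_congr fun ω => ?_
    rw [lintegral_exp_neg_mul_sq_add_mul (by norm_num), ENNReal.ofReal_mul (Real.sqrt_nonneg _)]
    congr 3
    · ring_nf
    · rw [mul_pow, hs]; ring
  have hright : ∫⁻ z : ℝ, ∫⁻ ω, ENNReal.ofReal
        (Real.exp (-(1 / 2) * z ^ 2 + (√(2 * ε) * X ω) * z)) ∂μ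
      ≤ ENNReal.ofReal √(2 * Real.pi) * ENNReal.ofReal
        ((1 - ε * K) ^ (-(1 : ℝ) / 2) * Real.exp (ε * m ^ 2 / (1 - ε * K))) := by
    calc _ ≤ ∫⁻ z : ℝ, ENNReal.ofReal
          (Real.exp (-((1 - ε * K) / 2) * z ^ 2 + (√(2 * ε) * m) * z)) := by
          refine lintegral_mono fun z => ?_
          have hz : ∀ ω, ENNReal.ofReal (Real.exp (-(1 / 2) * z ^ 2 + (√(2 * ε) * X ω) * z))
              = ENNReal.ofReal (Real.exp (-(1 / 2) * z ^ 2))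
                * ENNReal.ofReal (Real.exp ((√(2 * ε) * z) * X ω)) := fun ω => by
            rw [← ENNReal.ofReal_mul (Real.exp_pos _).le, ← Real.exp_add]
            ring_nf
          have hi : Integrable (fun ω => Real.exp ((√(2 * ε) * z) * X ω)) μ :=
            (huniv ▸ Set.mem_univ _ : (√(2 * ε) * z) ∈ integrableExpSet X μ)
          simp only [hz]
          rw [lintegral_const_mul _ (by fun_prop), ← ofReal_integral_eq_lintegral_ofReal hi
            (ae_of_all _ fun z => (Real.exp_pos _).le), ← ENNReal.ofReal_mul (Real.exp_pos _).le]
          refine ENNReal.ofReal_le_ofReal ?_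
          calc _ ≤ Real.exp (-(1 / 2) * z ^ 2) *
                Real.exp ((√(2 * ε) * z) * m + K * (√(2 * ε) * z) ^ 2 / 4) := by
                gcongr; exact hmgf _
            _ = _ := by
                rw [← Real.exp_add, mul_pow, hs]; ring_nf
      _ = _ := by
          rw [lintegral_exp_neg_mul_sq_add_mul (by positivity),
            ← ENNReal.ofReal_mul (Real.sqrt_nonneg _), ← mul_assoc]
          congr 3
          · rw [neg_div, Real.rpow_neg hd.le, ← Real.sqrt_eq_rpow, ← div_eq_mul_inv,
              ← Real.sqrt_div (by positivity)]
            congr 1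
            field_simp
          · rw [mul_pow, hs]; field_simp; ring
  have hswap := lintegral_lintegral_swap (μ := μ) (ν := (volume : Measure ℝ))
    (f := fun ω z => ENNReal.ofReal (Real.exp (-(1 / 2) * z ^ 2 + (√(2 * ε) * X ω) * z)))
    (by fun_prop)
  rw [← hswap, hleft] at hright
  exact (ENNReal.mul_le_mul_iff_right (ENNReal.ofReal_pos.2 hpi).ne' ENNReal.ofReal_ne_top).1 hright

theorem abs_max_min_le_abs (a : ℝ) {N : ℝ} (hN : 0 ≤ N) : |max (min a N) (-N)| ≤ |a| := by
  rcases abs_cases a with h | h <;> rw [h.1, abs_le] <;> constructor <;> grind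

theorem abs_max_min_le (a : ℝ) {N : ℝ} (hN : 0 ≤ N) : |max (min a N) (-N)| ≤ N :=
  abs_le.2 ⟨le_max_right _ _, max_le (min_le_right _ _) (by linarith)⟩

theorem eventually_max_min_natCast_eq (a : ℝ) :
    ∀ᶠ N : ℕ in atTop, max (min a N) (-N) = a := by
  filter_upwards [eventually_ge_atTop ⌈|a|⌉₊] with N hN
  have h := abs_le.1 (Nat.ceil_le.1 hN)
  rw [min_eq_left h.2, max_eq_left h.1]

/-- A `1`-Lipschitz function is integrable under a log-Sobolev inequality. -/
theorem SatisfiesLogSobolev.integrable {n : ℕ} {ν : Measure (EuclideanSpace ℝ (Fin n))}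
    [IsProbabilityMeasure ν] {K : ℝ} (hK : 0 < K) (hLSI : SatisfiesLogSobolev n ν K)
    {f : EuclideanSpace ℝ (Fin n) → ℝ} (hf : LipschitzWith 1 f) : Integrable f ν := by
  have hfc : Continuous f := hf.continuous
  set c : ℝ := ∫ x, Real.exp (-|f x|) ∂ν
  have hint : Integrable (fun x => Real.exp (-|f x|)) ν := by
    refine Integrable.of_bound (by fun_prop) 1 (ae_of_all _ fun x => ?_)
    rw [Real.norm_of_nonneg (Real.exp_pos _).le, Real.exp_le_one_iff]
    simp
  have hcpos : 0 < c := integral_exp_pos hint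
  have hlip : LipschitzWith 1 fun x => |f x| := by
    simpa [Function.comp_def] using (lipschitzWith_one_norm (E := ℝ)).comp hf
  have hmin : ∀ N : ℕ, ∀ x, |min |f x| N| ≤ N := fun N x => by
    rw [abs_of_nonneg (by positivity)]; exact min_le_right _ _
  have hmean : ∀ N : ℕ, ∫ x, min |f x| N ∂ν ≤ K / 4 - Real.log c := fun N => by
    have h := hLSI.mgf_le_exp hK (hlip.min_const N) (hmin N) (-1)
    have huniv := integrableExpSet_eq_univ_of_abs_le (μ := ν)
      (hlip.min_const N).continuous.aemeasurable (hmin N)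
    have hle : c ≤ mgf (fun x => min |f x| N) ν (-1) := by
      refine integral_mono hint
        (huniv ▸ Set.mem_univ _ : (-1 : ℝ) ∈ integrableExpSet (fun x => min |f x| N) ν) fun x => ?_
      rw [Real.exp_le_exp, neg_one_mul, neg_le_neg_iff]
      exact min_le_left _ _
    have := (Real.log_le_iff_le_exp hcpos).2 (hle.trans h)
    linarith
  refine ⟨hfc.aestronglyMeasurable, ?_⟩
  rw [hasFiniteIntegral_iff_norm]
  have hlim : ∀ x, liminf (fun N : ℕ => ENNReal.ofReal (min |f x| N)) atTop
      = ENNReal.ofReal ‖f x‖ := fun x => by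
    refine Tendsto.liminf_eq (tendsto_const_nhds.congr' ?_)
    filter_upwards [eventually_ge_atTop ⌈|f x|⌉₊] with N hN
    rw [min_eq_left (Nat.ceil_le.1 hN), Real.norm_eq_abs]
  calc ∫⁻ x, ENNReal.ofReal ‖f x‖ ∂ν
      = ∫⁻ x, liminf (fun N : ℕ => ENNReal.ofReal (min |f x| N)) atTop ∂ν := by simp only [hlim]
    _ ≤ liminf (fun N : ℕ => ∫⁻ x, ENNReal.ofReal (min |f x| N) ∂ν) atTop :=
        lintegral_liminf_le fun N => by fun_prop
    _ ≤ ENNReal.ofReal (K / 4 - Real.log c) := by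
        refine liminf_le_of_le (by isBoundedDefault) fun b hb => ?_
        obtain ⟨N, hN⟩ := hb.exists
        refine hN.trans ?_
        rw [← ofReal_integral_eq_lintegral_ofReal
          (Integrable.of_bound (by fun_prop) N (ae_of_all _ (hmin N)))
          (ae_of_all _ fun x => by positivity)]
        exact ENNReal.ofReal_le_ofReal (hmean N)
    _ < ⊤ := ENNReal.ofReal_lt_top

/-- Under a log-Sobolev inequality, the square of a `1`-Lipschitz function is
exponentially integrable, with an explicit bound. -/
theorem logSobolev_exp_square_bound (n : ℕ) (hn : 1 ≤ n)
    (ν : Measure (EuclideanSpace ℝ (Fin n))) [IsProbabilityMeasure ν]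
    (K : ℝ) (hK : 0 < K) (hLSI : SatisfiesLogSobolev n ν K)
    (f : EuclideanSpace ℝ (Fin n) → ℝ) (hf : LipschitzWith 1 f) :
    ∀ ε : ℝ, 0 < ε → ε * K < 1 →
      ∫⁻ x, ENNReal.ofReal (Real.exp (ε * (f x) ^ 2)) ∂ν
        ≤ ENNReal.ofReal ((1 - ε * K) ^ (-(1 : ℝ) / 2)
            * Real.exp (2 * ε * (∫ x, f x ∂ν) ^ 2 / (1 - ε * K))) := by
  intro ε hε hεK
  have hd : 0 < 1 - ε * K := by linarith
  have hfc : Continuous f := hf.continuous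
  have hint : Integrable f ν := hLSI.integrable hK hf
  set u : ℕ → EuclideanSpace ℝ (Fin n) → ℝ := fun N x => max (min (f x) N) (-N)
  have hlip : ∀ N, LipschitzWith 1 (u N) := fun N => (hf.min_const N).max_const (-N)
  have hbound : ∀ N x, |u N x| ≤ N := fun N x => abs_max_min_le (f x) N.cast_nonneg
  have hlimu : ∀ x, ∀ᶠ N in atTop, u N x = f x := fun x => eventually_max_min_natCast_eq (f x)
  have hmean : Tendsto (fun N => ∫ x, u N x ∂ν) atTop (𝓝 (∫ x, f x ∂ν)) :=
    tendsto_integral_of_dominated_convergence (fun x => |f x|)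
      (fun N => (hlip N).continuous.aestronglyMeasurable) hint.abs
      (fun N => ae_of_all _ fun x => abs_max_min_le_abs (f x) N.cast_nonneg)
      (ae_of_all _ fun x => tendsto_const_nhds.congr' ((hlimu x).mono fun _ h => h.symm))
  have hle : ∀ N, ∫⁻ x, ENNReal.ofReal (Real.exp (ε * u N x ^ 2)) ∂ν
      ≤ ENNReal.ofReal ((1 - ε * K) ^ (-(1 : ℝ) / 2)
        * Real.exp (ε * (∫ x, u N x ∂ν) ^ 2 / (1 - ε * K))) := fun N =>
    lintegral_exp_mul_sq_le_of_mgf_le (hlip N).continuous.measurable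
      (integrableExpSet_eq_univ_of_abs_le (hlip N).continuous.aemeasurable (hbound N))
      (hLSI.mgf_le_exp hK (hlip N) (hbound N)) hε hεK
  have hlim : Tendsto (fun N => ENNReal.ofReal ((1 - ε * K) ^ (-(1 : ℝ) / 2)
        * Real.exp (ε * (∫ x, u N x ∂ν) ^ 2 / (1 - ε * K)))) atTop
      (𝓝 (ENNReal.ofReal ((1 - ε * K) ^ (-(1 : ℝ) / 2)
        * Real.exp (ε * (∫ x, f x ∂ν) ^ 2 / (1 - ε * K))))) :=
    ENNReal.tendsto_ofReal ((Real.continuous_exp.tendsto _ |>.comp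
      (((hmean.pow 2).const_mul ε).div_const _)).const_mul _)
  calc ∫⁻ x, ENNReal.ofReal (Real.exp (ε * f x ^ 2)) ∂ν
      = ∫⁻ x, liminf (fun N => ENNReal.ofReal (Real.exp (ε * u N x ^ 2))) atTop ∂ν := by
        refine lintegral_congr fun x => (Tendsto.liminf_eq (tendsto_const_nhds.congr' ?_)).symm
        filter_upwards [hlimu x] with N hN
        rw [hN]
    _ ≤ liminf (fun N => ∫⁻ x, ENNReal.ofReal (Real.exp (ε * u N x ^ 2)) ∂ν) atTop :=
        lintegral_liminf_le fun N => by
          have := (hlip N).continuous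
          fun_prop
    _ ≤ liminf (fun N => ENNReal.ofReal ((1 - ε * K) ^ (-(1 : ℝ) / 2)
        * Real.exp (ε * (∫ x, u N x ∂ν) ^ 2 / (1 - ε * K)))) atTop :=
        liminf_le_liminf (Eventually.of_forall hle)
    _ = ENNReal.ofReal ((1 - ε * K) ^ (-(1 : ℝ) / 2)
        * Real.exp (ε * (∫ x, f x ∂ν) ^ 2 / (1 - ε * K))) := hlim.liminf_eq
    _ ≤ _ := by
        gcongr
        linarith
end
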